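/- arXiv:2209.12273 — 4 statements merged into one kernel-verified Lean document; each statement's English description precedes it below -/
import Mathlib

section
/- Let s ≠ t be vertices and let F ⊆ E satisfy the capacity condition for (s,t), with 𝒞 its family of violated cuts. For each safe edge e ∈ 𝒮, the family 𝒞_e = {A ∈ 𝒞 : e ∈ δ_F(A)} is a ring family: whenever A, B ∈ 𝒞_e properly intersect, both A ∩ B and A ∪ B belong to 𝒞_e, and if 𝒞_e is nonempty it has a unique inclusion-minimal member. -/
open scoped BigOperators

/-- An edge `e` crosses the vertex set `A` if exactly one of its endpoints lies in `A`. -/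
def crosses {V E : Type*} (ends : E → Sym2 V) (A : Set V) (e : E) : Prop :=
  ∃ u v : V, ends e = s(u, v) ∧ u ∈ A ∧ v ∉ A

/-- `cut ends F A` is `δ_F(A)`: the set of edges of `F` with exactly one endpoint in `A`. -/
def cut {V E : Type*} (ends : E → Sym2 V) (F : Set E) (A : Set V) : Set E :=
  {e | e ∈ F ∧ crosses ends A e}

/-- Two vertex sets properly intersect. -/
def properlyIntersect {V : Type*} (A B : Set V) : Prop :=
  (A ∩ B).Nonempty ∧ (A \ B).Nonempty ∧ (B \ A).Nonempty

/-- `F` satisfies the capacity condition for the pair `(s,t)`. -/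
def capCond {V E : Type*} (ends : E → Sym2 V) (𝒮 𝒰 : Set E) (s t : V) (F : Set E) : Prop :=
  ∀ A : Set V, s ∈ A → t ∉ A →
    4 ≤ 2 * (cut ends (F ∩ 𝒮) A).ncard + (cut ends (F ∩ 𝒰) A).ncard

/-- The family of violated cuts of `F` for the `(2,2)`-Flex-ST augmentation. -/
def violatedST {V E : Type*} (ends : E → Sym2 V) (𝒮 𝒰 : Set E) (s t : V) (F : Set E) :
    Set (Set V) :=
  {A | s ∈ A ∧ t ∉ A ∧ (cut ends (F ∩ 𝒮) A).ncard = 1 ∧ (cut ends (F ∩ 𝒰) A).ncard = 2}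

theorem crosses_iff_of_ends_eq {V E : Type*} {ends : E → Sym2 V} {f : E} {u v : V}
    (h : ends f = s(u, v)) (A : Set V) :
    crosses ends A f ↔ (u ∈ A ∧ v ∉ A) ∨ (v ∈ A ∧ u ∉ A) := by
  constructor
  · rintro ⟨x, y, hxy, hx, hy⟩
    rw [h, Sym2.eq_iff] at hxy
    rcases hxy with ⟨rfl, rfl⟩ | ⟨rfl, rfl⟩
    · exact Or.inl ⟨hx, hy⟩
    · exact Or.inr ⟨hx, hy⟩
  · rintro (⟨hu, hv⟩ | ⟨hv, hu⟩)
    · exact ⟨u, v, h, hu, hv⟩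
    · exact ⟨v, u, h.trans Sym2.eq_swap, hv, hu⟩

theorem cut_inter_union_cut_union_subset {V E : Type*} (ends : E → Sym2 V) (F : Set E)
    (A B : Set V) :
    cut ends F (A ∩ B) ∪ cut ends F (A ∪ B) ⊆ cut ends F A ∪ cut ends F B := by
  intro f
  obtain ⟨u, v, h⟩ : ∃ u v, ends f = s(u, v) := (ends f).ind fun u v => ⟨u, v, rfl⟩
  simp only [cut, Set.mem_union, Set.mem_ofPred_eq, crosses_iff_of_ends_eq h, Set.mem_inter_iff]
  tauto

theorem cut_inter_inter_cut_union_subset {V E : Type*} (ends : E → Sym2 V) (F : Set E)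
    (A B : Set V) :
    cut ends F (A ∩ B) ∩ cut ends F (A ∪ B) ⊆ cut ends F A ∩ cut ends F B := by
  intro f
  obtain ⟨u, v, h⟩ : ∃ u v, ends f = s(u, v) := (ends f).ind fun u v => ⟨u, v, rfl⟩
  simp only [cut, Set.mem_union, Set.mem_ofPred_eq, crosses_iff_of_ends_eq h, Set.mem_inter_iff]
  tauto

/-- The cut function is submodular. -/
theorem ncard_cut_inter_add_ncard_cut_union_le {V E : Type*} [Finite E] (ends : E → Sym2 V)
    (F : Set E) (A B : Set V) :
    (cut ends F (A ∩ B)).ncard + (cut ends F (A ∪ B)).ncard ≤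
      (cut ends F A).ncard + (cut ends F B).ncard := by
  rw [← Set.ncard_union_add_ncard_inter, ← Set.ncard_union_add_ncard_inter (cut ends F A)]
  exact add_le_add (Set.ncard_le_ncard (cut_inter_union_cut_union_subset ends F A B))
    (Set.ncard_le_ncard (cut_inter_inter_cut_union_subset ends F A B))

/-- An edge crossing both `A` and `B` either crosses both `A ∩ B` and `A ∪ B`, or joins `A \ B`
to `B \ A` and crosses neither. -/
theorem crosses_inter_and_union_or_not {V E : Type*} {ends : E → Sym2 V} {A B : Set V} {f : E}
    (hA : crosses ends A f) (hB : crosses ends B f) :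
    (crosses ends (A ∩ B) f ∧ crosses ends (A ∪ B) f) ∨
      (¬ crosses ends (A ∩ B) f ∧ ¬ crosses ends (A ∪ B) f) := by
  obtain ⟨u, v, h⟩ : ∃ u v, ends f = s(u, v) := (ends f).ind fun u v => ⟨u, v, rfl⟩
  simp only [crosses_iff_of_ends_eq h, Set.mem_union, Set.mem_inter_iff] at *
  tauto

theorem cut_eq_singleton_of_ncard_eq_one {V E : Type*} {ends : E → Sym2 V} {F : Set E}
    {A : Set V} {f : E} (h : (cut ends F A).ncard = 1) (hf : f ∈ cut ends F A) :
    cut ends F A = {f} := by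
  obtain ⟨g, hg⟩ := Set.ncard_eq_one.mp h
  rw [hg, Set.mem_singleton_iff] at hf
  rw [hg, hf]

/-- Violated cuts through a common safe edge are closed under intersection and union. -/
theorem violatedST_inter_union {V E : Type*} [Finite E] {ends : E → Sym2 V} {𝒮 𝒰 : Set E}
    {s t : V} {F : Set E} (hF : capCond ends 𝒮 𝒰 s t F) {e : E} (he : e ∈ 𝒮) {A B : Set V}
    (hA : A ∈ violatedST ends 𝒮 𝒰 s t F) (heA : e ∈ cut ends F A)
    (hB : B ∈ violatedST ends 𝒮 𝒰 s t F) (heB : e ∈ cut ends F B) :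
    (A ∩ B ∈ violatedST ends 𝒮 𝒰 s t F ∧ e ∈ cut ends F (A ∩ B)) ∧
      (A ∪ B ∈ violatedST ends 𝒮 𝒰 s t F ∧ e ∈ cut ends F (A ∪ B)) := by
  obtain ⟨hsA, htA, hSA, hUA⟩ := hA
  obtain ⟨hsB, htB, hSB, hUB⟩ := hB
  have hsI : s ∈ A ∩ B := ⟨hsA, hsB⟩
  have htI : t ∉ A ∩ B := fun h => htA h.1
  have hsU : s ∈ A ∪ B := Or.inl hsA
  have htU : t ∉ A ∪ B := fun h => h.elim htA htB
  have hsub := cut_inter_union_cut_union_subset ends (F ∩ 𝒮) A B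
  rw [cut_eq_singleton_of_ncard_eq_one hSA ⟨⟨heA.1, he⟩, heA.2⟩,
    cut_eq_singleton_of_ncard_eq_one hSB ⟨⟨heB.1, he⟩, heB.2⟩, Set.union_self,
    Set.union_subset_iff] at hsub
  have hcapI := hF _ hsI htI
  have hcapU := hF _ hsU htU
  have hsubmod := ncard_cut_inter_add_ncard_cut_union_le ends (F ∩ 𝒰) A B
  rcases crosses_inter_and_union_or_not heA.2 heB.2 with ⟨hI, hU⟩ | ⟨hI, hU⟩
  · have hSI : (cut ends (F ∩ 𝒮) (A ∩ B)).ncard = 1 := Set.ncard_eq_one.mpr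
      ⟨e, hsub.1.antisymm (Set.singleton_subset_iff.mpr ⟨⟨heA.1, he⟩, hI⟩)⟩
    have hSU : (cut ends (F ∩ 𝒮) (A ∪ B)).ncard = 1 := Set.ncard_eq_one.mpr
      ⟨e, hsub.2.antisymm (Set.singleton_subset_iff.mpr ⟨⟨heA.1, he⟩, hU⟩)⟩
    exact ⟨⟨⟨hsI, htI, hSI, by omega⟩, heA.1, hI⟩, ⟨⟨hsU, htU, hSU, by omega⟩, heA.1, hU⟩⟩
  · have hempty : ∀ X : Set V, cut ends (F ∩ 𝒮) X ⊆ {e} → ¬ crosses ends X e →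
        (cut ends (F ∩ 𝒮) X).ncard = 0 := by
      intro X hX hcross
      rw [Set.ncard_eq_zero, Set.eq_empty_iff_forall_notMem]
      intro f hf
      obtain rfl : f = e := hX hf
      exact hcross hf.2
    have hSI := hempty _ hsub.1 hI
    have hSU := hempty _ hsub.2 hU
    omega

theorem stmt3 {V E : Type*} [Fintype V] [Fintype E]
    (ends : E → Sym2 V) (𝒮 𝒰 : Set E)
    (hpart : 𝒮 ∪ 𝒰 = Set.univ) (hdisj : Disjoint 𝒮 𝒰)
    (s t : V) (hst : s ≠ t)
    (F : Set E) (hF : capCond ends 𝒮 𝒰 s t F)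
    (e : E) (he : e ∈ 𝒮)
    (Ce : Set (Set V))
    (hCe : Ce = {A ∈ violatedST ends 𝒮 𝒰 s t F | e ∈ cut ends F A}) :
    (∀ A B, A ∈ Ce → B ∈ Ce → properlyIntersect A B → A ∩ B ∈ Ce ∧ A ∪ B ∈ Ce) ∧
    (Ce.Nonempty → ∃! M, M ∈ Ce ∧ ∀ A ∈ Ce, A ⊆ M → A = M) := by
  subst hCe
  have hclosed := fun {A B : Set V} => violatedST_inter_union hF he (A := A) (B := B)
  refine ⟨fun A B hA hB _ => hclosed hA.1 hA.2 hB.1 hB.2, fun hne => ?_⟩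
  obtain ⟨M, hM⟩ := (Set.toFinite _).exists_minimal hne
  refine ⟨M, ⟨hM.prop, fun A hA hAM => hAM.antisymm (hM.le_of_le hA hAM)⟩, ?_⟩
  rintro N ⟨hN, hNmin⟩
  have hI := (hclosed hM.prop.1 hM.prop.2 hN.1 hN.2).1
  exact (hNmin _ hI Set.inter_subset_right).symm.trans
    (Set.inter_subset_left.antisymm (hM.le_of_le hI Set.inter_subset_left))
end

section
/- Let p ≥ 2 be any integer and 0 ≤ i ≤ p−2. Let H ⊆ E be feasible for (p,3)-FGC such that for every A with ∅ ≠ A ⊊ V, if |δ_H(A)| = p+3 then |δ_{H∩𝒮}(A)| ≥ i. Then the family 𝒞_i = {A ⊆ V : ∅ ≠ A ⊊ V, |δ_H(A)| = p+3 and |δ_{H∩𝒮}(A)| = i} is uncrossable (the evenness of p is only needed when i = p−1). -/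
open scoped BigOperators

/-- `F` is feasible for `(p,q)`-FGC. -/
def fgcFeasible {V E : Type*} (ends : E → Sym2 V) (𝒮 : Set E) (p q : ℕ) (F : Set E) : Prop :=
  ∀ A : Set V, A.Nonempty → A ≠ Set.univ →
    p ≤ (cut ends (F ∩ 𝒮) A).ncard ∨ p + q ≤ (cut ends F A).ncard

/-- Two properly intersecting members of the family `𝒞` uncross. -/
def uncross {V : Type*} (𝒞 : Set (Set V)) (A B : Set V) : Prop :=
  (A ∩ B ∈ 𝒞 ∧ A ∪ B ∈ 𝒞) ∨ (A \ B ∈ 𝒞 ∧ B \ A ∈ 𝒞)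

/-- The family `𝒞` is uncrossable. -/
def uncrossable {V : Type*} (𝒞 : Set (Set V)) : Prop :=
  ∀ A B, A ∈ 𝒞 → B ∈ 𝒞 → properlyIntersect A B → uncross 𝒞 A B

/-- The edges of `F` with one endpoint in `X` and the other in `Y`. -/
def edgesBetween {V E : Type*} (ends : E → Sym2 V) (F : Set E) (X Y : Set V) : Set E :=
  {e | e ∈ F ∧ ∃ u v : V, ends e = s(u, v) ∧ u ∈ X ∧ v ∈ Y}

section EdgesBetween

variable {V E : Type*} (ends : E → Sym2 V) (F : Set E)

theorem cut_eq_edgesBetween_compl (A : Set V) : cut ends F A = edgesBetween ends F A Aᶜ := rfl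

theorem edgesBetween_comm (X Y : Set V) :
    edgesBetween ends F X Y = edgesBetween ends F Y X := by
  ext e
  constructor <;> rintro ⟨he, u, v, h, hu, hv⟩ <;>
    exact ⟨he, v, u, h.trans Sym2.eq_swap, hv, hu⟩

theorem cut_compl (A : Set V) : cut ends F Aᶜ = cut ends F A := by
  rw [cut_eq_edgesBetween_compl, cut_eq_edgesBetween_compl, compl_compl, edgesBetween_comm]

theorem edgesBetween_mono {F G : Set E} (h : F ⊆ G) (X Y : Set V) :
    edgesBetween ends F X Y ⊆ edgesBetween ends G X Y :=
  fun _ he => ⟨h he.1, he.2⟩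

theorem ncard_edgesBetween_union_right [Finite E] {X Y Z : Set V}
    (hXY : Disjoint X Y) (hYZ : Disjoint Y Z) :
    (edgesBetween ends F X (Y ∪ Z)).ncard =
      (edgesBetween ends F X Y).ncard + (edgesBetween ends F X Z).ncard := by
  rw [← Set.ncard_union_eq _ (Set.toFinite _) (Set.toFinite _)]
  · congr 1
    ext e
    simp only [edgesBetween, Set.mem_ofPred_eq, Set.mem_union]
    grind
  · rw [Set.disjoint_left] at *
    rintro e ⟨-, u, v, h, hu, hv⟩ ⟨-, u', v', h', hu', hv'⟩
    rw [h, Sym2.eq_iff] at h'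
    rcases h' with ⟨rfl, rfl⟩ | ⟨rfl, rfl⟩
    · exact hYZ hv hv'
    · exact hXY hu' hv

theorem ncard_edgesBetween_union_left [Finite E] {X Y Z : Set V}
    (hXY : Disjoint X Y) (hXZ : Disjoint X Z) :
    (edgesBetween ends F (X ∪ Y) Z).ncard =
      (edgesBetween ends F X Z).ncard + (edgesBetween ends F Y Z).ncard := by
  rw [edgesBetween_comm, ncard_edgesBetween_union_right ends F hXZ.symm hXY,
    edgesBetween_comm ends F Z X, edgesBetween_comm ends F Z Y]

theorem ncard_cut_of_compl_eq [Finite E] {X Y Z W : Set V} (h : Xᶜ = Y ∪ (Z ∪ W))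
    (hYZ : Disjoint Y Z) (hYW : Disjoint Y W) (hZW : Disjoint Z W) :
    (cut ends F X).ncard = (edgesBetween ends F X Y).ncard +
      (edgesBetween ends F X Z).ncard + (edgesBetween ends F X W).ncard := by
  have hX : Disjoint X (Y ∪ (Z ∪ W)) := h ▸ disjoint_compl_right
  simp only [Set.disjoint_union_right] at hX
  rw [cut_eq_edgesBetween_compl, h,
    ncard_edgesBetween_union_right ends F hX.1 (hYZ.union_right hYW),
    ncard_edgesBetween_union_right ends F hX.2.1 hZW, add_assoc]

theorem ncard_cut_union_of_compl_eq [Finite E] {X Y Z W : Set V} (h : (X ∪ Y)ᶜ = Z ∪ W)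
    (hXY : Disjoint X Y) (hZW : Disjoint Z W) :
    (cut ends F (X ∪ Y)).ncard = (edgesBetween ends F X Z).ncard +
      (edgesBetween ends F X W).ncard + (edgesBetween ends F Y Z).ncard +
      (edgesBetween ends F Y W).ncard := by
  have hX : Disjoint (X ∪ Y) (Z ∪ W) := h ▸ disjoint_compl_right
  simp only [Set.disjoint_union_right, Set.disjoint_union_left] at hX
  obtain ⟨⟨hXZ, hYZ⟩, hXW, hYW⟩ := hX
  rw [cut_eq_edgesBetween_compl, h,
    ncard_edgesBetween_union_right ends F (hXZ.union_left hYZ) hZW,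
    ncard_edgesBetween_union_left ends F hXY hXZ,
    ncard_edgesBetween_union_left ends F hXY hXW]
  ring

/-- The cuts of two sets and of their four corners, in terms of the numbers of edges between
corners. -/
theorem ncard_cut_corners [Finite E] (A B : Set V) :
    let e := fun X Y => (edgesBetween ends F X Y).ncard
    let a := A ∩ B
    let b := A \ B
    let c := B \ A
    let d := (A ∪ B)ᶜ
    (cut ends F A).ncard = e a c + e a d + e b c + e b d ∧
    (cut ends F B).ncard = e a b + e a d + e b c + e c d ∧
    (cut ends F (A ∩ B)).ncard = e a b + e a c + e a d ∧
    (cut ends F (A \ B)).ncard = e a b + e b c + e b d ∧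
    (cut ends F (B \ A)).ncard = e a c + e b c + e c d ∧
    (cut ends F (A ∪ B)).ncard = e a d + e b d + e c d := by
  intro e a b c d
  have hab : Disjoint a b := Set.disjoint_left.2 (by grind)
  have hac : Disjoint a c := Set.disjoint_left.2 (by grind)
  have had : Disjoint a d := Set.disjoint_left.2 (by grind)
  have hbc : Disjoint b c := Set.disjoint_left.2 (by grind)
  have hbd : Disjoint b d := Set.disjoint_left.2 (by grind)
  have hcd : Disjoint c d := Set.disjoint_left.2 (by grind)
  have hA : a ∪ b = A := by grind
  have hB : a ∪ c = B := by grind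
  have comm : ∀ X Y, e X Y = e Y X := fun X Y => by simp only [e, edgesBetween_comm ends F X Y]
  have cutA := ncard_cut_union_of_compl_eq ends F (X := a) (Y := b) (Z := c) (W := d)
    (by ext; grind) hab hcd
  have cutB := ncard_cut_union_of_compl_eq ends F (X := a) (Y := c) (Z := b) (W := d)
    (by ext; grind) hac hbd
  have cuta := ncard_cut_of_compl_eq ends F (X := a) (Y := b) (Z := c) (W := d)
    (by ext; grind) hbc hbd hcd
  have cutb := ncard_cut_of_compl_eq ends F (X := b) (Y := a) (Z := c) (W := d)
    (by ext; grind) hac had hcd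
  have cutc := ncard_cut_of_compl_eq ends F (X := c) (Y := a) (Z := b) (W := d)
    (by ext; grind) hab had hbd
  have cutd := ncard_cut_of_compl_eq ends F (X := d) (Y := a) (Z := b) (W := c)
    (by ext; grind) hab hac hbc
  rw [hA] at cutA
  rw [hB] at cutB
  rw [cut_compl] at cutd
  have hba := comm b a
  have hca := comm c a
  have hcb := comm c b
  have hda := comm d a
  have hdb := comm d b
  have hdc := comm d c
  refine ⟨?_, ?_, ?_, ?_, ?_, ?_⟩ <;> grind

end EdgesBetween

section Corners

variable {p i sx sy tx ty : ℕ}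

/-- If a corner has at least `p` safe edges, its cut has at most `p + 2` edges, where `sy` and `ty`
count the safe edges and all edges of the opposite corner. -/
theorem le_of_safe_opposite (hi : i + 2 ≤ p) (hsx : p ≤ sx) (hs : sx + sy ≤ 2 * i)
    (ht : tx + ty ≤ 2 * (p + 3)) (hy : p ≤ sy ∨ p + 3 ≤ ty) (hyi : ty = p + 3 → i ≤ sy) :
    tx ≤ p + 2 := by
  omega

/-- Two adjacent corners, with `e` safe edges among the `f` edges joining them, cannot both have at
least `p` safe edges and at most `p + 2` edges. -/
theorem false_of_safe_adjacent {e f : ℕ} (hi : i + 2 ≤ p) (hsx : p ≤ sx) (htx : tx ≤ p + 2)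
    (hsy : p ≤ sy) (hty : ty ≤ p + 2) (hs : sx + sy = 2 * e + i)
    (ht : tx + ty = 2 * f + (p + 3)) (hef : e ≤ f) : False := by
  omega

/-- Two opposite corners with fewer than `p` safe edges each are both tight. -/
theorem eq_of_not_safe (hsx : sx < p) (hsy : sy < p) (ht : tx + ty ≤ 2 * (p + 3))
    (hs : sx + sy ≤ 2 * i) (hx : p ≤ sx ∨ p + 3 ≤ tx) (hy : p ≤ sy ∨ p + 3 ≤ ty)
    (hxi : tx = p + 3 → i ≤ sx) (hyi : ty = p + 3 → i ≤ sy) :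
    (tx = p + 3 ∧ sx = i) ∧ ty = p + 3 ∧ sy = i := by
  omega

end Corners

theorem stmt11 {V E : Type*} [Fintype V] [Fintype E]
    (ends : E → Sym2 V) (𝒮 𝒰 : Set E)
    (hpart : 𝒮 ∪ 𝒰 = Set.univ) (hdisj : Disjoint 𝒮 𝒰)
    (p i : ℕ) (hp : 2 ≤ p) (hi : i ≤ p - 2)
    (H : Set E) (hfeas : fgcFeasible ends 𝒮 p 3 H)
    (hH : ∀ A : Set V, A.Nonempty → A ≠ Set.univ →
      (cut ends H A).ncard = p + 3 → i ≤ (cut ends (H ∩ 𝒮) A).ncard) :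
    uncrossable {A : Set V | A.Nonempty ∧ A ≠ Set.univ ∧
      (cut ends H A).ncard = p + 3 ∧ (cut ends (H ∩ 𝒮) A).ncard = i} := by
  rintro A B ⟨hA, hA', hAt, hAs⟩ ⟨hB, hB', hBt, hBs⟩ ⟨ha, hb, hc⟩
  replace hi : i + 2 ≤ p := by omega
  by_cases hd : A ∪ B = Set.univ
  · have hAB : A \ B = Bᶜ := by
      ext x
      have : x ∈ A ∪ B := hd ▸ Set.mem_univ x
      grind
    have hBA : B \ A = Aᶜ := by
      ext x
      have : x ∈ A ∪ B := hd ▸ Set.mem_univ x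
      grind
    refine Or.inr ⟨⟨hb, ?_, ?_⟩, hc, ?_, ?_⟩
    · rwa [hAB, Ne, Set.compl_univ_iff, ← Ne, ← Set.nonempty_iff_ne_empty]
    · rw [hAB, cut_compl, cut_compl]
      exact ⟨hBt, hBs⟩
    · rwa [hBA, Ne, Set.compl_univ_iff, ← Ne, ← Set.nonempty_iff_ne_empty]
    · rw [hBA, cut_compl, cut_compl]
      exact ⟨hAt, hAs⟩
  have ha' : A ∩ B ≠ Set.univ := fun h => hA' (Set.univ_subset_iff.1 (h ▸ Set.inter_subset_left))
  have hb' : A \ B ≠ Set.univ := fun h => hA' (Set.univ_subset_iff.1 (h ▸ Set.sdiff_subset))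
  have hc' : B \ A ≠ Set.univ := fun h => hB' (Set.univ_subset_iff.1 (h ▸ Set.sdiff_subset))
  have hU : (A ∪ B).Nonempty := hA.inl
  have le : ∀ X Y, (edgesBetween ends (H ∩ 𝒮) X Y).ncard ≤ (edgesBetween ends H X Y).ncard :=
    fun X Y => Set.ncard_le_ncard (edgesBetween_mono ends Set.inter_subset_left X Y)
      (Set.toFinite _)
  have hab := le (A ∩ B) (A \ B)
  have hac := le (A ∩ B) (B \ A)
  have hbd := le (A \ B) (A ∪ B)ᶜ
  have hcd := le (B \ A) (A ∪ B)ᶜ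
  obtain ⟨tA, tB, ta, tb, tc, td⟩ := ncard_cut_corners ends H A B
  obtain ⟨sA, sB, sa, sb, sc, sd⟩ := ncard_cut_corners ends (H ∩ 𝒮) A B
  have fa := hfeas _ ha ha'
  have fb := hfeas _ hb hb'
  have fc := hfeas _ hc hc'
  have fd := hfeas _ hU hd
  have ia := hH _ ha ha'
  have ib := hH _ hb hb'
  have ic := hH _ hc hc'
  have id := hH _ hU hd
  simp only [uncross, Set.mem_ofPred_eq, ha, hb, hc, hU, ha', hb', hc', hd, ne_eq,
    not_false_eq_true, true_and]
  dsimp only at tA tB ta tb tc td sA sB sa sb sc sd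
  have adt : (cut ends H (A ∩ B)).ncard + (cut ends H (A ∪ B)).ncard ≤ 2 * (p + 3) := by linarith
  have bct : (cut ends H (A \ B)).ncard + (cut ends H (B \ A)).ncard ≤ 2 * (p + 3) := by linarith
  have ads : (cut ends (H ∩ 𝒮) (A ∩ B)).ncard + (cut ends (H ∩ 𝒮) (A ∪ B)).ncard ≤ 2 * i := by
    linarith
  have bcs : (cut ends (H ∩ 𝒮) (A \ B)).ncard + (cut ends (H ∩ 𝒮) (B \ A)).ncard ≤ 2 * i := by
    linarith
  by_cases had : p ≤ (cut ends (H ∩ 𝒮) (A ∩ B)).ncard ∨ p ≤ (cut ends (H ∩ 𝒮) (A ∪ B)).ncard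
  · by_cases hbc : p ≤ (cut ends (H ∩ 𝒮) (A \ B)).ncard ∨ p ≤ (cut ends (H ∩ 𝒮) (B \ A)).ncard
    · exfalso
      rcases had with h | h
      · have h' := le_of_safe_opposite hi h ads adt fd id
        rcases hbc with k | k
        · exact false_of_safe_adjacent hi h h' k (le_of_safe_opposite hi k bcs bct fc ic)
            (by linarith) (by linarith) hab
        · rw [add_comm] at bcs bct
          exact false_of_safe_adjacent hi h h' k (le_of_safe_opposite hi k bcs bct fb ib)
            (by linarith) (by linarith) hac
      · rw [add_comm] at ads adt
        have h' := le_of_safe_opposite hi h ads adt fa ia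
        rcases hbc with k | k
        · exact false_of_safe_adjacent hi h h' k (le_of_safe_opposite hi k bcs bct fc ic)
            (by linarith) (by linarith) hbd
        · rw [add_comm] at bcs bct
          exact false_of_safe_adjacent hi h h' k (le_of_safe_opposite hi k bcs bct fb ib)
            (by linarith) (by linarith) hcd
    · push Not at hbc
      exact Or.inr (eq_of_not_safe hbc.1 hbc.2 bct bcs fb fc ib ic)
  · push Not at had
    exact Or.inl (eq_of_not_safe had.1 had.2 adt ads fa fd ia id)
end

section
/- For every odd integer p ≥ 3 there exist a multigraph (a finite vertex type V, finite edge type E, endpoint map ends : E → Sym2 V) with a partition of E into safe edges 𝒮 and unsafe edges 𝒰, a set F ⊆ E feasible for (p,3)-FGC, and properly intersecting sets A, B ⊆ V with |δ_{F∩𝒮}(A)| = |δ_{F∩𝒮}(B)| = p−1 and |δ_F(A)| = |δ_F(B)| = p+3 (so A and B are violated cuts, with exactly p−1 safe edges each, for the augmentation from (p,3)-FGC to (p,4)-FGC), such that none of A ∪ B, A ∩ B, A \ B, B \ A is violated, where a set C is violated if |δ_F(C)| = p+3 and |δ_{F∩𝒮}(C)| ≤ p−1. In particular A and B do not uncross.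 -/
open scoped BigOperators

theorem crosses_iff {V E : Type*} {ends : E → Sym2 V} {A : Set V} {e : E} {a b : V}
    (h : ends e = s(a, b)) :
    crosses ends A e ↔ (a ∈ A ∧ b ∉ A) ∨ (b ∈ A ∧ a ∉ A) := by
  unfold crosses
  rw [h]
  constructor
  · rintro ⟨u, v, huv, hu, hv⟩
    rcases Sym2.eq_iff.mp huv with ⟨rfl, rfl⟩ | ⟨rfl, rfl⟩
    · exact Or.inl ⟨hu, hv⟩
    · exact Or.inr ⟨hu, hv⟩
  · rintro (⟨ha, hb⟩ | ⟨hb, ha⟩)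
    · exact ⟨a, b, rfl, ha, hb⟩
    · exact ⟨b, a, Sym2.eq_swap, hb, ha⟩

theorem ncard_sigma_fin_setOf {C : Type*} [Fintype C] (m : C → ℕ) (P : C → Prop)
    [DecidablePred P] :
    {e : Σ c, Fin (m c) | P e.1}.ncard = ∑ c, if P c then m c else 0 := by
  have h : {e : Σ c, Fin (m c) | P e.1} =
      ((Finset.univ.filter P).sigma fun c => (Finset.univ : Finset (Fin (m c))) :
        Finset (Σ c, Fin (m c))) := by
    ext e
    simp
  rw [h, Set.ncard_coe_finset, Finset.card_sigma, Finset.sum_filter]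
  simp

/-- The classes of parallel edges of the counterexample: a 4-cycle `0, 1, 3, 2` in which every
side except `01` carries both a safe and an unsafe class. -/
def cycleEnds : Fin 7 → Fin 4 × Fin 4 :=
  ![(0, 1), (0, 2), (1, 3), (2, 3), (0, 2), (1, 3), (2, 3)]

/-- Multiplicities of the edge classes, for `p = 2 * k + 3`; the first four classes are safe. -/
def cycleMult (k : ℕ) : Fin 7 → ℕ :=
  ![k + 2, k + 1, k + 1, k, 2, 2, 4]

/-- The endpoint map of the counterexample. -/
def cycleGraph (k : ℕ) (e : Σ c, Fin (cycleMult k c)) : Sym2 (Fin 4) :=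
  s((cycleEnds e.1).1, (cycleEnds e.1).2)

/-- The safe edges of the counterexample. -/
def cycleSafe (k : ℕ) : Set (Σ c, Fin (cycleMult k c)) :=
  {e | e.1 < 4}

open Classical in
theorem ncard_cut_cycleGraph (k : ℕ) (Q : Fin 7 → Prop) (A : Set (Fin 4)) :
    (cut (cycleGraph k) {e | Q e.1} A).ncard =
      ∑ c, if Q c ∧ (((cycleEnds c).1 ∈ A ∧ (cycleEnds c).2 ∉ A) ∨
        ((cycleEnds c).2 ∈ A ∧ (cycleEnds c).1 ∉ A)) then cycleMult k c else 0 := by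
  refine Eq.trans ?_ (ncard_sigma_fin_setOf (cycleMult k) fun c =>
    Q c ∧ (((cycleEnds c).1 ∈ A ∧ (cycleEnds c).2 ∉ A) ∨
      ((cycleEnds c).2 ∈ A ∧ (cycleEnds c).1 ∉ A)))
  congr 1
  ext e
  exact and_congr_right fun _ => crosses_iff rfl

open Classical in
theorem ncard_cut_cycleGraph_safe (k : ℕ) (A : Set (Fin 4)) :
    (cut (cycleGraph k) (Set.univ ∩ cycleSafe k) A).ncard =
      (if (0 ∈ A ↔ 1 ∈ A) then 0 else k + 2) + (if (0 ∈ A ↔ 2 ∈ A) then 0 else k + 1) +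
      (if (1 ∈ A ↔ 3 ∈ A) then 0 else k + 1) + (if (2 ∈ A ↔ 3 ∈ A) then 0 else k) := by
  rw [Set.univ_inter]
  refine (ncard_cut_cycleGraph k (· < 4) A).trans ?_
  by_cases h0 : 0 ∈ A <;> by_cases h1 : 1 ∈ A <;> by_cases h2 : 2 ∈ A <;> by_cases h3 : 3 ∈ A <;>
    simp [Fin.sum_univ_succ, cycleEnds, cycleMult, h0, h1, h2, h3, Fin.lt_def] <;> ring

open Classical in
theorem ncard_cut_cycleGraph_univ (k : ℕ) (A : Set (Fin 4)) :
    (cut (cycleGraph k) Set.univ A).ncard =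
      (if (0 ∈ A ↔ 1 ∈ A) then 0 else k + 2) + (if (0 ∈ A ↔ 2 ∈ A) then 0 else k + 3) +
      (if (1 ∈ A ↔ 3 ∈ A) then 0 else k + 3) + (if (2 ∈ A ↔ 3 ∈ A) then 0 else k + 4) := by
  refine (ncard_cut_cycleGraph k (fun _ => True) A).trans ?_
  by_cases h0 : 0 ∈ A <;> by_cases h1 : 1 ∈ A <;> by_cases h2 : 2 ∈ A <;> by_cases h3 : 3 ∈ A <;>
    simp [Fin.sum_univ_succ, cycleEnds, cycleMult, h0, h1, h2, h3] <;> ring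

theorem fgcFeasible_cycleGraph (k : ℕ) :
    fgcFeasible (cycleGraph k) (cycleSafe k) (2 * k + 3) 3 Set.univ := by
  intro A hne huniv
  rw [ncard_cut_cycleGraph_safe, ncard_cut_cycleGraph_univ]
  by_cases h0 : 0 ∈ A <;> by_cases h1 : 1 ∈ A <;> by_cases h2 : 2 ∈ A <;> by_cases h3 : 3 ∈ A <;>
    simp only [h0, h1, h2, h3, iff_true, iff_false, not_true, if_true, if_false] <;> try omega
  · exact absurd (Set.eq_univ_of_forall fun x => by fin_cases x <;> assumption) huniv
  · obtain ⟨x, hx⟩ := hne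
    fin_cases x <;> contradiction

theorem stmt13 (p : ℕ) (hp : 3 ≤ p) (hodd : Odd p) :
    ∃ (V E : Type) (_ : Fintype V) (_ : Fintype E) (ends : E → Sym2 V)
      (𝒮 𝒰 : Set E) (F : Set E) (A B : Set V),
      𝒮 ∪ 𝒰 = Set.univ ∧ Disjoint 𝒮 𝒰 ∧
      fgcFeasible ends 𝒮 p 3 F ∧
      properlyIntersect A B ∧
      (cut ends F A).ncard = p + 3 ∧ (cut ends F B).ncard = p + 3 ∧
      (cut ends (F ∩ 𝒮) A).ncard = p - 1 ∧ (cut ends (F ∩ 𝒮) B).ncard = p - 1 ∧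
      ¬((cut ends F (A ∪ B)).ncard = p + 3 ∧ (cut ends (F ∩ 𝒮) (A ∪ B)).ncard ≤ p - 1) ∧
      ¬((cut ends F (A ∩ B)).ncard = p + 3 ∧ (cut ends (F ∩ 𝒮) (A ∩ B)).ncard ≤ p - 1) ∧
      ¬((cut ends F (A \ B)).ncard = p + 3 ∧ (cut ends (F ∩ 𝒮) (A \ B)).ncard ≤ p - 1) ∧
      ¬((cut ends F (B \ A)).ncard = p + 3 ∧ (cut ends (F ∩ 𝒮) (B \ A)).ncard ≤ p - 1) := by
  obtain ⟨k, rfl⟩ : ∃ k, p = 2 * k + 3 := by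
    obtain ⟨j, rfl⟩ := hodd
    exact ⟨j - 1, by omega⟩
  refine ⟨Fin 4, Σ c, Fin (cycleMult k c), inferInstance, inferInstance, cycleGraph k,
    cycleSafe k, (cycleSafe k)ᶜ, Set.univ, {0, 1}, {0, 2}, Set.union_compl_self _,
    disjoint_compl_right, fgcFeasible_cycleGraph k,
    ⟨⟨0, by simp⟩, ⟨1, by simp⟩, ⟨2, by simp⟩⟩, ?_⟩
  simp only [ncard_cut_cycleGraph_safe, ncard_cut_cycleGraph_univ]
  simp
  omega
end

section
/- There exist a multigraph (a finite vertex type V, finite edge type E, endpoint map ends : E → Sym2 V) with a partition of E into safe edges 𝒮 and unsafe edges 𝒰, a set F ⊆ E feasible for (4,4)-FGC, and properly intersecting sets A, B ⊆ V that are both violated for the augmentation from (4,4)-FGC to (4,5)-FGC — i.e., |δ_F(A)| = |δ_F(B)| = 8 and |δ_{F∩𝒮}(A)| ≤ 3, |δ_{F∩𝒮}(B)| ≤ 3 — such that none of A ∪ B, A ∩ B, A \ B, B \ A is violated, where a set C is violated if |δ_F(C)| = 8 and |δ_{F∩𝒮}(C)| ≤ 3. In particular A and B do not uncross. -/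
open scoped BigOperators

/-- The size of a cut, in terms of explicit endpoints and finite sets of edges and vertices. -/
theorem ncard_cut_coe {V E : Type*} [DecidableEq V] (tail head : E → V)
    (F : Finset E) (A : Finset V) :
    (cut (fun e => s(tail e, head e)) (F : Set E) (A : Set V)).ncard =
      (F.filter fun e => decide (tail e ∈ A) ≠ decide (head e ∈ A)).card := by
  rw [← Set.ncard_coe_finset]
  congr 1
  ext e
  simp only [cut, crosses, Set.mem_ofPred_eq, Finset.coe_filter, Finset.mem_coe, ne_eq,
    decide_eq_decide, Sym2.eq_iff]
  refine and_congr_right fun _ => ⟨?_, fun h => ?_⟩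
  · rintro ⟨u, v, ⟨rfl, rfl⟩ | ⟨rfl, rfl⟩, hu, hv⟩ <;> tauto
  · by_cases ht : tail e ∈ A
    · exact ⟨tail e, head e, .inl ⟨rfl, rfl⟩, ht, by tauto⟩
    · exact ⟨head e, tail e, .inr ⟨rfl, rfl⟩, by tauto, ht⟩

/-- First endpoints of the 16 edges of the example on the vertices `0, 1, 2, 3`, where
`A = {0, 1}` and `B = {0, 2}`. -/
def exampleTail : Fin 16 → Fin 4 := ![2, 2, 2, 1, 0, 1, 1, 1, 0, 0, 0, 0, 0, 0, 0, 0]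

/-- Second endpoints of the edges of the example. -/
def exampleHead : Fin 16 → Fin 4 := ![3, 3, 3, 3, 2, 3, 3, 3, 2, 2, 2, 1, 1, 1, 1, 1]

/-- The safe edges of the example: three copies of `23`, one of `13` and one of `02`. -/
def exampleSafe : Finset (Fin 16) := {0, 1, 2, 3, 4}

theorem fgcFeasible_example :
    fgcFeasible (fun e => s(exampleTail e, exampleHead e)) (exampleSafe : Set (Fin 16)) 4 4
      ((Finset.univ : Finset (Fin 16)) : Set (Fin 16)) := by
  intro A hA hA'
  lift A to Finset (Fin 4) using A.toFinite
  rw [← Finset.coe_inter, ncard_cut_coe, ncard_cut_coe]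
  rw [Finset.coe_nonempty] at hA
  rw [ne_eq, Finset.coe_eq_univ] at hA'
  revert A
  decide +kernel

theorem stmt14 :
    ∃ (V E : Type) (_ : Fintype V) (_ : Fintype E) (ends : E → Sym2 V)
      (𝒮 𝒰 : Set E) (F : Set E) (A B : Set V),
      𝒮 ∪ 𝒰 = Set.univ ∧ Disjoint 𝒮 𝒰 ∧
      fgcFeasible ends 𝒮 4 4 F ∧
      properlyIntersect A B ∧
      (cut ends F A).ncard = 8 ∧ (cut ends F B).ncard = 8 ∧
      (cut ends (F ∩ 𝒮) A).ncard ≤ 3 ∧ (cut ends (F ∩ 𝒮) B).ncard ≤ 3 ∧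
      ¬((cut ends F (A ∪ B)).ncard = 8 ∧ (cut ends (F ∩ 𝒮) (A ∪ B)).ncard ≤ 3) ∧
      ¬((cut ends F (A ∩ B)).ncard = 8 ∧ (cut ends (F ∩ 𝒮) (A ∩ B)).ncard ≤ 3) ∧
      ¬((cut ends F (A \ B)).ncard = 8 ∧ (cut ends (F ∩ 𝒮) (A \ B)).ncard ≤ 3) ∧
      ¬((cut ends F (B \ A)).ncard = 8 ∧ (cut ends (F ∩ 𝒮) (B \ A)).ncard ≤ 3) := by
  refine ⟨Fin 4, Fin 16, inferInstance, inferInstance, fun e => s(exampleTail e, exampleHead e),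
    (exampleSafe : Set (Fin 16)), (exampleSafe : Set (Fin 16))ᶜ,
    ((Finset.univ : Finset (Fin 16)) : Set (Fin 16)),
    (({0, 1} : Finset (Fin 4)) : Set (Fin 4)), (({0, 2} : Finset (Fin 4)) : Set (Fin 4)),
    Set.union_compl_self _, disjoint_compl_right, fgcFeasible_example, ?_⟩
  simp only [properlyIntersect, ← Finset.coe_inter, ← Finset.coe_union, ← Finset.coe_sdiff,
    ncard_cut_coe, Finset.coe_nonempty]
  decide +kernel
end
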